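/- Let f be a regular function in F_op with Morozova-Chentsov function c, let ρ be a positive definite bipartite density matrix on ℂ^n ⊗ ℂ^m with partial traces ρ₁ = Tr₂ρ and ρ₂ = Tr₁ρ, let A be an n×n complex Hermitian matrix and B an m×m complex Hermitian matrix. Then I^c_ρ(A ⊗ 1₂ + 1₁ ⊗ B) ≥ (1/2)·(I^c_{ρ₁}(A) + I^c_{ρ₂}(B)). -/

import Mathlib

open Matrix Kronecker ComplexOrder

/-- Functional calculus: apply `g : ℝ → ℝ` to a Hermitian matrix via its spectral
decomposition (junk value `0` on non-Hermitian matrices). -/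
noncomputable def matFun {ι : Type} [Fintype ι] [DecidableEq ι] (g : ℝ → ℝ)
    (M : Matrix ι ι ℂ) : Matrix ι ι ℂ :=
  if hM : M.IsHermitian then
    ∑ i, (g (hM.eigenvalues i) : ℂ) •
      Matrix.vecMulVec (⇑(hM.eigenvectorBasis i)) (star ⇑(hM.eigenvectorBasis i))
  else 0

/-- Operator monotonicity on `(0,∞)`: monotone w.r.t. the Loewner order on positive
definite complex Hermitian matrices of all sizes. -/
def OperatorMonotone (g : ℝ → ℝ) : Prop :=
  ∀ (k : ℕ) (A B : Matrix (Fin k) (Fin k) ℂ), A.PosDef → B.PosDef →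
    (B - A).PosSemidef → (matFun g B - matFun g A).PosSemidef

/-- Operator convexity on `(0,∞)` for positive definite complex Hermitian matrices
of all sizes. -/
def OperatorConvex (g : ℝ → ℝ) : Prop :=
  ∀ (k : ℕ) (A B : Matrix (Fin k) (Fin k) ℂ), A.PosDef → B.PosDef →
    ∀ t : ℝ, 0 ≤ t → t ≤ 1 →
      (t • matFun g A + (1 - t) • matFun g B - matFun g (t • A + (1 - t) • B)).PosSemidef

/-- `ĉ(x,y) = (x-y)² · c(x,y)` where `c(x,y) = 1/(y·f(x/y))` is the
Morozova-Chentsov function associated with `f`. -/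
noncomputable def chat (f : ℝ → ℝ) (x y : ℝ) : ℝ :=
  (x - y) ^ 2 * (1 / (y * f (x / y)))

/-- The quadratic form `Σ_{k,l} ĉ(λ_k,λ_l)·|⟨u_k, A u_l⟩|²` computed from the spectral
decomposition of the Hermitian matrix `ρ` (junk value `0` on non-Hermitian matrices). -/
noncomputable def skewSum {ι : Type} [Fintype ι] [DecidableEq ι] (f : ℝ → ℝ)
    (ρ A : Matrix ι ι ℂ) : ℝ :=
  if hρ : ρ.IsHermitian then
    ∑ i, ∑ j, chat f (hρ.eigenvalues i) (hρ.eigenvalues j) *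
      Complex.normSq (star ⇑(hρ.eigenvectorBasis i) ⬝ᵥ A *ᵥ ⇑(hρ.eigenvectorBasis j))
  else 0

/-- The metric adjusted skew information
`I^c_ρ(A) = (f(0)/2)·Σ_{k,l} ĉ(λ_k,λ_l)·|⟨u_k, A u_l⟩|²`. -/
noncomputable def Ic {ι : Type} [Fintype ι] [DecidableEq ι] (f : ℝ → ℝ)
    (ρ A : Matrix ι ι ℂ) : ℝ :=
  (f 0 / 2) * skewSum f ρ A

/-- Partial trace over the second factor. -/
noncomputable def ptrace2 {n m : ℕ} (ρ : Matrix (Fin n × Fin m) (Fin n × Fin m) ℂ) :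
    Matrix (Fin n) (Fin n) ℂ :=
  Matrix.of fun i i' => ∑ j, ρ (i, j) (i', j)

/-- Partial trace over the first factor. -/
noncomputable def ptrace1 {n m : ℕ} (ρ : Matrix (Fin n × Fin m) (Fin n × Fin m) ℂ) :
    Matrix (Fin m) (Fin m) ℂ :=
  Matrix.of fun j j' => ∑ i, ρ (i, j) (i, j')

section FunctionalCalculus

variable {ι κ : Type} [Fintype ι] [DecidableEq ι] [Fintype κ] [DecidableEq κ]

lemma Matrix.IsHermitian.eq_eigenvectorUnitary_mul {M : Matrix ι ι ℂ} (hM : M.IsHermitian) :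
    M = (hM.eigenvectorUnitary : Matrix ι ι ℂ) * diagonal (fun i => (hM.eigenvalues i : ℂ)) *
      (hM.eigenvectorUnitary : Matrix ι ι ℂ)ᴴ := by
  have h := hM.spectral_theorem
  rw [Unitary.conjStarAlgAut_apply] at h
  exact h

lemma matFun_eq_eigenvectorUnitary_mul (g : ℝ → ℝ) {M : Matrix ι ι ℂ} (hM : M.IsHermitian) :
    matFun g M = (hM.eigenvectorUnitary : Matrix ι ι ℂ) *
      diagonal (fun i => (g (hM.eigenvalues i) : ℂ)) *
      (hM.eigenvectorUnitary : Matrix ι ι ℂ)ᴴ := by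
  ext a b
  rw [matFun, dif_pos hM, Matrix.sum_apply, Matrix.mul_apply]
  refine Finset.sum_congr rfl fun i _ => ?_
  simp [Matrix.mul_diagonal, vecMulVec_apply]
  ring

/-- A functional calculus acts on eigenvectors through the eigenvalues. -/
lemma matFun_mul_of_mul_eq (g : ℝ → ℝ) {M : Matrix ι ι ℂ} (hM : M.IsHermitian)
    {X : Matrix ι κ ℂ} {e : κ → ℝ} (h : M * X = X * diagonal (fun j => (e j : ℂ))) :
    matFun g M * X = X * diagonal (fun j => (g (e j) : ℂ)) := by
  set U : Matrix ι ι ℂ := (hM.eigenvectorUnitary : Matrix ι ι ℂ) with hU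
  have hU1 : Uᴴ * U = 1 := (Unitary.mem_iff.mp hM.eigenvectorUnitary.2).1
  have hU2 : U * Uᴴ = 1 := (Unitary.mem_iff.mp hM.eigenvectorUnitary.2).2
  have hd : diagonal (fun i => (hM.eigenvalues i : ℂ)) * (Uᴴ * X) =
      (Uᴴ * X) * diagonal (fun j => (e j : ℂ)) := by
    calc _ = Uᴴ * U * diagonal (fun i => (hM.eigenvalues i : ℂ)) * (Uᴴ * X) := by
          rw [hU1, Matrix.one_mul]
      _ = Uᴴ * (U * diagonal (fun i => (hM.eigenvalues i : ℂ)) * Uᴴ * X) := by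
          simp only [Matrix.mul_assoc]
      _ = _ := by rw [hU, ← hM.eq_eigenvectorUnitary_mul, h, Matrix.mul_assoc]
  have hg : diagonal (fun i => (g (hM.eigenvalues i) : ℂ)) * (Uᴴ * X) =
      (Uᴴ * X) * diagonal (fun j => (g (e j) : ℂ)) := by
    ext i j
    have hij := congrFun (congrFun hd i) j
    rw [Matrix.diagonal_mul, Matrix.mul_diagonal] at hij ⊢
    by_cases h0 : (Uᴴ * X) i j = 0
    · simp [h0]
    · have : hM.eigenvalues i = e j := by
        rw [mul_comm] at hij
        exact_mod_cast mul_left_cancel₀ h0 hij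
      rw [this, mul_comm]
  rw [matFun_eq_eigenvectorUnitary_mul g hM, Matrix.mul_assoc, Matrix.mul_assoc, hg,
    ← Matrix.mul_assoc, ← Matrix.mul_assoc, hU2, Matrix.one_mul]

lemma matFun_diagonal (g : ℝ → ℝ) (d : ι → ℝ) :
    matFun g (diagonal fun i => (d i : ℂ)) = diagonal fun i => (g (d i) : ℂ) := by
  have hM : (diagonal fun i => (d i : ℂ)).IsHermitian :=
    isHermitian_diagonal_of_self_adjoint _ (by ext i; simp)
  simpa using matFun_mul_of_mul_eq g hM (X := 1) (e := d) (by simp)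

end FunctionalCalculus

namespace OperatorMonotone

variable {f : ℝ → ℝ}

lemma le_of_le (hf : OperatorMonotone f) {x y : ℝ} (hx : 0 < x) (hxy : x ≤ y) : f x ≤ f y := by
  have hd : ∀ t : ℝ, 0 < t → (diagonal fun _ : Fin 1 => (t : ℂ)).PosDef := fun t ht =>
    PosDef.diagonal fun _ => by exact_mod_cast ht
  have h := hf 1 _ _ (hd x hx) (hd y (hx.trans_le hxy)) (by
    rw [diagonal_sub]
    refine PosSemidef.diagonal fun _ => ?_
    have : (0 : ℝ) ≤ y - x := sub_nonneg.2 hxy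
    simpa using (by exact_mod_cast this : (0 : ℂ) ≤ ((y - x : ℝ) : ℂ)))
  rw [matFun_diagonal f fun _ => y, matFun_diagonal f fun _ => x, diagonal_sub] at h
  have h0 := h.diag_nonneg (i := 0)
  rw [diagonal_apply_eq, ← Complex.ofReal_sub] at h0
  exact sub_nonneg.1 (by exact_mod_cast h0)

lemma map_mul_le (hf : OperatorMonotone f) (hf_symm : ∀ t > 0, f t = t * f (1 / t))
    {s t : ℝ} (hs : 1 ≤ s) (ht : 0 < t) : f (s * t) ≤ s * f t := by
  have hst : 0 < s * t := by positivity
  rw [hf_symm _ hst, hf_symm t ht, ← mul_assoc]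
  refine mul_le_mul_of_nonneg_left ?_ hst.le
  exact hf.le_of_le (by positivity) (one_div_le_one_div_of_le ht (le_mul_of_one_le_left ht.le hs))

/-- Compression inequality: if `W` is an isometry compressing `diagonal d` to `diagonal e`, then
it compresses `f (diagonal d)` below `f (s • diagonal e)` for every `s > 1`. -/
lemma compression_le {k : ℕ} {κ : Type} [Fintype κ] [DecidableEq κ] (hf : OperatorMonotone f)
    {d : Fin k → ℝ} {e : κ → ℝ} (hd : ∀ i, 0 < d i) {W : Matrix (Fin k) κ ℂ}
    (hW : Wᴴ * W = 1)
    (hWd : Wᴴ * diagonal (fun i => (d i : ℂ)) * W = diagonal fun j => (e j : ℂ))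
    {ε : ℝ} (hε : 0 < ε) :
    ((diagonal fun j => (f ((1 + ε) * e j) : ℂ)) -
      Wᴴ * diagonal (fun i => (f (d i) : ℂ)) * W).PosSemidef := by
  set D : Matrix (Fin k) (Fin k) ℂ := diagonal (fun i => (d i : ℂ)) with hD
  set P := W * Wᴴ with hP
  set Q := 1 - P with hQ
  have hPP : P * P = P := by
    rw [hP, ← Matrix.mul_assoc, Matrix.mul_assoc W, hW, Matrix.mul_one]
  have hQQ : Q * Q = Q := by
    rw [hQ]; simp [mul_sub, sub_mul, hPP]
  have hPh : Pᴴ = P := by simp [hP]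
  have hQh : Qᴴ = Q := by simp [hQ, hPh]
  have hPW : P * W = W := by rw [hP, Matrix.mul_assoc, hW, Matrix.mul_one]
  have hQW : Q * W = 0 := by rw [hQ, Matrix.sub_mul, hPW, Matrix.one_mul, sub_self]
  have hDpos : D.PosDef := PosDef.diagonal fun i => by exact_mod_cast hd i
  obtain ⟨l, hl⟩ : ∃ l : ℝ, ∀ i, (1 + ε⁻¹) * d i ≤ l :=
    ⟨∑ i, (1 + ε⁻¹) * d i, fun i => Finset.single_le_sum (f := fun i => (1 + ε⁻¹) * d i)
      (fun i _ => (mul_pos (by positivity) (hd i)).le) (Finset.mem_univ i)⟩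
  set M : Matrix (Fin k) (Fin k) ℂ := (1 + (ε : ℂ)) • (P * D * P) + (l : ℂ) • Q with hM
  have hεc : (ε : ℂ) ≠ 0 := by exact_mod_cast hε.ne'
  have hdiff : (M - D).PosSemidef := by
    have h1 : (((ε : ℂ) • P - Q) * D * ((ε : ℂ) • P - Q)ᴴ).PosSemidef :=
      hDpos.posSemidef.mul_mul_conjTranspose_same _
    have h2 : (Q * diagonal (fun i => ((l - (1 + ε⁻¹) * d i : ℝ) : ℂ)) * Qᴴ).PosSemidef := by
      refine PosSemidef.mul_mul_conjTranspose_same (PosSemidef.diagonal fun i => ?_) _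
      have := sub_nonneg.2 (hl i)
      show (0 : ℂ) ≤ _
      exact_mod_cast this
    have hc : (0 : ℂ) ≤ ((ε⁻¹ : ℝ) : ℂ) := by exact_mod_cast (inv_pos.2 hε).le
    have key : M - D = ((ε⁻¹ : ℝ) : ℂ) • (((ε : ℂ) • P - Q) * D * ((ε : ℂ) • P - Q)ᴴ) +
        Q * diagonal (fun i => ((l - (1 + ε⁻¹) * d i : ℝ) : ℂ)) * Qᴴ := by
      have e1 : (diagonal (fun i => ((l - (1 + ε⁻¹) * d i : ℝ) : ℂ)) :
          Matrix (Fin k) (Fin k) ℂ) = (l : ℂ) • 1 - (1 + (ε : ℂ)⁻¹) • D := by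
        ext i j
        by_cases hij : i = j
        · subst hij; simp [hD]
        · simp [hD, hij]
      have e2 : D = P * D * P + P * D * Q + Q * D * P + Q * D * Q := by
        simp only [hQ, mul_sub, sub_mul, Matrix.one_mul, Matrix.mul_one]; abel
      have e3 : ((ε : ℂ) • P - Q)ᴴ = (ε : ℂ) • P - Q := by
        simp [conjTranspose_sub, conjTranspose_smul, hPh, hQh]
      rw [e1, e3, hQh]
      nth_rewrite 1 [e2]
      simp only [hM, mul_sub, sub_mul, Matrix.smul_mul, Matrix.mul_smul, Matrix.mul_one, hQQ,
        Complex.ofReal_inv]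
      match_scalars <;> field_simp <;> ring
    rw [key]
    exact (h1.smul hc).add h2
  have hMpos : M.PosDef := by
    have := hDpos.add_posSemidef hdiff
    rwa [add_sub_cancel] at this
  have hMW : M * W = W * diagonal (fun j => (((1 + ε) * e j : ℝ) : ℂ)) := by
    have e1 : (diagonal (fun j => (((1 + ε) * e j : ℝ) : ℂ)) : Matrix κ κ ℂ) =
        (1 + (ε : ℂ)) • diagonal fun j => (e j : ℂ) := by
      ext i j
      by_cases hij : i = j
      · subst hij; simp
      · simp [hij]
    rw [hM, Matrix.add_mul, Matrix.smul_mul, Matrix.smul_mul, hQW, smul_zero, add_zero,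
      Matrix.mul_assoc, hPW, e1, Matrix.mul_smul, ← hWd, hP]
    simp only [Matrix.mul_assoc]
  have h := (hf k D M hDpos hMpos hdiff).conjTranspose_mul_mul_same W
  rwa [Matrix.mul_sub, Matrix.sub_mul, Matrix.mul_assoc,
    matFun_mul_of_mul_eq f hMpos.isHermitian hMW, ← Matrix.mul_assoc, hW, Matrix.one_mul, hD,
    matFun_diagonal] at h

end OperatorMonotone

section Jensen

lemma star_dotProduct_conjTranspose_diagonal_mulVec {ι κ : Type} [Fintype ι] [DecidableEq ι]
    [Fintype κ] (W : Matrix ι κ ℂ) (g : ι → ℝ) (z : κ → ℂ) :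
    star z ⬝ᵥ (Wᴴ * diagonal (fun i => (g i : ℂ)) * W) *ᵥ z =
      ((∑ i, g i * Complex.normSq ((W *ᵥ z) i) : ℝ) : ℂ) := by
  rw [Matrix.mul_assoc, ← Matrix.mulVec_mulVec, Matrix.dotProduct_mulVec, ← Matrix.star_mulVec,
    ← Matrix.mulVec_mulVec]
  simp only [dotProduct, Matrix.mulVec_diagonal, Pi.star_apply, Complex.ofReal_sum,
    Complex.ofReal_mul, Complex.normSq_eq_conj_mul_self]
  exact Finset.sum_congr rfl fun i _ => by rw [Complex.star_def]; ring

variable {ι κ : Type} [Fintype ι] [DecidableEq ι] [Fintype κ] [DecidableEq κ]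

namespace OperatorMonotone

variable {f : ℝ → ℝ}

/-- Jensen's inequality for a symmetric operator monotone function and an isometry compressing
one diagonal matrix to another. -/
lemma sum_mul_normSq_le_of_isometry (hf : OperatorMonotone f) (hf_pos : ∀ t > 0, 0 < f t)
    (hf_symm : ∀ t > 0, f t = t * f (1 / t)) {d : ι → ℝ} {e : κ → ℝ}
    (hd : ∀ i, 0 < d i) (he : ∀ j, 0 < e j) {W : Matrix ι κ ℂ} (hW : Wᴴ * W = 1)
    (hWd : Wᴴ * diagonal (fun i => (d i : ℂ)) * W = diagonal fun j => (e j : ℂ)) (z : κ → ℂ) :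
    ∑ i, f (d i) * Complex.normSq ((W *ᵥ z) i) ≤ ∑ j, f (e j) * Complex.normSq (z j) := by
  set σ := (Fintype.equivFin ι).symm with hσ
  set V : Matrix (Fin (Fintype.card ι)) κ ℂ := W.submatrix σ id with hV
  have hVV : Vᴴ * V = 1 := by
    rw [hV, conjTranspose_submatrix, submatrix_mul_equiv, hW, submatrix_id_id]
  have hVd : Vᴴ * diagonal (fun i => (d (σ i) : ℂ)) * V = diagonal fun j => (e j : ℂ) := by
    have : (diagonal fun i => (d (σ i) : ℂ)) = (diagonal fun i => (d i : ℂ)).submatrix σ σ :=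
      (submatrix_diagonal_equiv (fun i => (d i : ℂ)) σ).symm
    rw [this, hV, conjTranspose_submatrix, submatrix_mul_equiv, submatrix_mul_equiv, hWd,
      submatrix_id_id]
  have hnonneg : 0 ≤ ∑ j, f (e j) * Complex.normSq (z j) :=
    Finset.sum_nonneg fun j _ => mul_nonneg (hf_pos _ (he j)).le (Complex.normSq_nonneg _)
  have key : ∀ ε : ℝ, 0 < ε → ∑ i, f (d i) * Complex.normSq ((W *ᵥ z) i) ≤
      (1 + ε) * ∑ j, f (e j) * Complex.normSq (z j) := by
    intro ε hε
    have h := (hf.compression_le (fun i => hd (σ i)) hVV hVd hε).dotProduct_mulVec_nonneg z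
    have h1 := star_dotProduct_conjTranspose_diagonal_mulVec (1 : Matrix κ κ ℂ)
      (fun j => f ((1 + ε) * e j)) z
    rw [conjTranspose_one, Matrix.one_mul, Matrix.mul_one, Matrix.one_mulVec] at h1
    rw [Matrix.sub_mulVec, dotProduct_sub, h1,
      star_dotProduct_conjTranspose_diagonal_mulVec V (fun i => f (d (σ i))),
      ← Complex.ofReal_sub] at h
    have h2 := sub_nonneg.1 (Complex.zero_le_real.1 h)
    have h3 : ∑ i, f (d (σ i)) * Complex.normSq ((V *ᵥ z) i) =
        ∑ i, f (d i) * Complex.normSq ((W *ᵥ z) i) :=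
      Equiv.sum_comp σ fun i => f (d i) * Complex.normSq ((W *ᵥ z) i)
    rw [← h3]
    refine h2.trans ?_
    rw [Finset.mul_sum]
    refine Finset.sum_le_sum fun j _ => ?_
    rw [← mul_assoc]
    exact mul_le_mul_of_nonneg_right (hf.map_mul_le hf_symm (by linarith) (he j))
      (Complex.normSq_nonneg _)
  by_contra! hlt
  set a := ∑ i, f (d i) * Complex.normSq ((W *ᵥ z) i)
  set b := ∑ j, f (e j) * Complex.normSq (z j)
  have hb : 0 < b + 1 := by linarith
  have h := key ((a - b) / (b + 1)) (div_pos (by linarith) hb)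
  have h' : (a - b) / (b + 1) * (b + 1) = a - b := div_mul_cancel₀ _ hb.ne'
  have : 0 < (a - b) / (b + 1) := div_pos (by linarith) hb
  nlinarith

/-- Weighted form of `OperatorMonotone.sum_mul_normSq_le_of_isometry`. -/
lemma sum_weight_mul_normSq_le (hf : OperatorMonotone f) (hf_pos : ∀ t > 0, 0 < f t)
    (hf_symm : ∀ t > 0, f t = t * f (1 / t)) {p d : ι → ℝ} {q e : κ → ℝ}
    (hp : ∀ i, 0 < p i) (hd : ∀ i, 0 < d i) (hq : ∀ j, 0 < q j) (he : ∀ j, 0 < e j)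
    {G : Matrix ι κ ℂ}
    (hG : Gᴴ * diagonal (fun i => (p i : ℂ)) * G = diagonal fun j => (q j : ℂ))
    (hGd : Gᴴ * diagonal (fun i => ((p i * d i : ℝ) : ℂ)) * G =
      diagonal fun j => ((q j * e j : ℝ) : ℂ)) (z : κ → ℂ) :
    ∑ i, p i * f (d i) * Complex.normSq ((G *ᵥ z) i) ≤
      ∑ j, q j * f (e j) * Complex.normSq (z j) := by
  set R : Matrix ι ι ℂ := diagonal fun i => ((√(p i) : ℝ) : ℂ) with hR
  set S : Matrix κ κ ℂ := diagonal fun j => ((√(q j) : ℝ) : ℂ) with hS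
  set T : Matrix κ κ ℂ := diagonal fun j => (((√(q j))⁻¹ : ℝ) : ℂ) with hT
  have hq0 : ∀ j, √(q j) ≠ 0 := fun j => (Real.sqrt_pos.2 (hq j)).ne'
  have hRh : Rᴴ = R := by rw [hR, diagonal_conjTranspose]; congr 1; ext i; simp
  have hTh : Tᴴ = T := by rw [hT, diagonal_conjTranspose]; congr 1; ext i; simp
  have hRR : ∀ g : ι → ℝ, R * diagonal (fun i => (g i : ℂ)) * R =
      diagonal fun i => ((p i * g i : ℝ) : ℂ) := fun g => by
    rw [hR, diagonal_mul_diagonal, diagonal_mul_diagonal]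
    congr 1; ext i
    norm_cast
    nth_rewrite 3 [← Real.mul_self_sqrt (hp i).le]
    ring
  have hTT : ∀ g : κ → ℝ, T * diagonal (fun j => ((q j * g j : ℝ) : ℂ)) * T =
      diagonal fun j => (g j : ℂ) := fun g => by
    rw [hT, diagonal_mul_diagonal, diagonal_mul_diagonal]
    congr 1; ext j
    norm_cast
    nth_rewrite 2 [← Real.mul_self_sqrt (hq j).le]
    have := hq0 j
    field_simp
  have hW : ∀ g : ι → ℝ, (R * G * T)ᴴ * diagonal (fun i => (g i : ℂ)) * (R * G * T) =
      T * (Gᴴ * diagonal (fun i => ((p i * g i : ℝ) : ℂ)) * G) * T := fun g => by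
    rw [conjTranspose_mul, conjTranspose_mul, hRh, hTh, ← hRR]
    simp only [Matrix.mul_assoc]
  have hW1 : (R * G * T)ᴴ * (R * G * T) = 1 := by
    have h := hW fun _ => 1
    have h' := hTT fun _ => 1
    simp only [mul_one, Complex.ofReal_one, diagonal_one, Matrix.mul_one] at h h'
    rw [h, hG, h']
  have h := hf.sum_mul_normSq_le_of_isometry hf_pos hf_symm hd he hW1
    (by rw [hW, hGd, hTT]) (S *ᵥ z)
  have hTS : T * S = 1 := by
    rw [hT, hS, diagonal_mul_diagonal, ← diagonal_one]
    congr 1; ext j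
    norm_cast
    exact inv_mul_cancel₀ (hq0 j)
  rw [Matrix.mulVec_mulVec, Matrix.mul_assoc, hTS, Matrix.mul_one, ← Matrix.mulVec_mulVec] at h
  have hsq : ∀ (x : ℝ) (_ : 0 < x) (w : ℂ),
      Complex.normSq (((√x : ℝ) : ℂ) * w) = x * Complex.normSq w := fun x hx w => by
    rw [Complex.normSq_mul, Complex.normSq_ofReal, Real.mul_self_sqrt hx.le]
  simp only [hR, hS, Matrix.mulVec_diagonal, hsq _ (hp _), hsq _ (hq _)] at h
  calc _ = _ := Finset.sum_congr rfl fun i _ => by ring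
    _ ≤ _ := h
    _ = _ := Finset.sum_congr rfl fun i _ => by ring

end OperatorMonotone

end Jensen

section Monotonicity

lemma trace_mul_conjTranspose_eq_sum {ι : Type} [Fintype ι] (X Y : Matrix ι ι ℂ) :
    (X * Yᴴ).trace = ∑ i : ι × ι, X i.1 i.2 * star (Y i.1 i.2) := by
  simp [Matrix.trace, Matrix.mul_apply, Fintype.sum_prod_type]

variable {ι κ : Type} [Fintype ι] [DecidableEq ι] [Fintype κ] [DecidableEq κ]

lemma trace_diagonal_mul_conjTranspose_mul (p : ι → ℂ) (X Y : Matrix ι ι ℂ) :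
    (diagonal p * (Xᴴ * Y)).trace = ∑ i : ι × ι, star (X i.1 i.2) * p i.2 * Y i.1 i.2 := by
  rw [Fintype.sum_prod_type, Finset.sum_comm]
  simp only [Matrix.trace, Matrix.diag_apply, Matrix.diagonal_mul]
  simp only [Matrix.mul_apply, Matrix.conjTranspose_apply, Finset.mul_sum]
  exact Finset.sum_congr rfl fun _ _ => Finset.sum_congr rfl fun _ _ => by ring

lemma trace_diagonal_mul_mul_conjTranspose (p : ι → ℂ) (X Y : Matrix ι ι ℂ) :
    (diagonal p * (Y * Xᴴ)).trace = ∑ i : ι × ι, star (X i.1 i.2) * p i.1 * Y i.1 i.2 := by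
  rw [Fintype.sum_prod_type]
  simp only [Matrix.trace, Matrix.diag_apply, Matrix.diagonal_mul]
  simp only [Matrix.mul_apply, Matrix.conjTranspose_apply, Finset.mul_sum]
  exact Finset.sum_congr rfl fun _ _ => Finset.sum_congr rfl fun _ _ => by ring

lemma sum_star_single_mul_single (p : κ × κ → ℂ) (i j : κ × κ) :
    ∑ c : κ × κ, star (single i.1 i.2 (1 : ℂ) c.1 c.2) * p c * single j.1 j.2 (1 : ℂ) c.1 c.2 =
      diagonal p i j := by
  have hs : ∀ i c : κ × κ, single i.1 i.2 (1 : ℂ) c.1 c.2 = if i = c then 1 else 0 := fun i c => by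
    simp [single_apply, Prod.ext_iff]
  simp only [hs, diagonal_apply]
  rw [Finset.sum_eq_single i]
  · by_cases h : i = j
    · simp [h]
    · simp [h, Ne.symm h]
  · intro c _ hc
    simp [hc.symm]
  · simp

/-- Monotonicity of the metric adjusted skew information in diagonalising bases: `φ` is the
inclusion of the observables of a subsystem. -/
lemma sum_chat_mul_normSq_le {f : ℝ → ℝ} (hf : OperatorMonotone f) (hf_pos : ∀ t > 0, 0 < f t)
    (hf_symm : ∀ t > 0, f t = t * f (1 / t)) {l : ι → ℝ} {μ : κ → ℝ}
    (hl : ∀ i, 0 < l i) (hμ : ∀ a, 0 < μ a) (φ : Matrix κ κ ℂ →ₗ[ℂ] Matrix ι ι ℂ)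
    (hφ_mul : ∀ X Y, φ (X * Y) = φ X * φ Y) (hφ_star : ∀ X, φ Xᴴ = (φ X)ᴴ)
    (hφ_tr : ∀ X, (diagonal (fun i => (l i : ℂ)) * φ X).trace =
      (diagonal (fun a => (μ a : ℂ)) * X).trace)
    {H : Matrix ι ι ℂ} {A : Matrix κ κ ℂ}
    (hHA : ∀ X, ((diagonal (fun i => (l i : ℂ)) * H - H * diagonal (fun i => (l i : ℂ))) *
      φ X).trace =
      ((diagonal (fun a => (μ a : ℂ)) * A - A * diagonal (fun a => (μ a : ℂ))) * X).trace) :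
    ∑ a, ∑ b, chat f (μ a) (μ b) * Complex.normSq (A a b) ≤
      ∑ i, ∑ j, chat f (l i) (l j) * Complex.normSq (H i j) := by
  simp only [← Fintype.sum_prod_type']
  set G : Matrix (ι × ι) (κ × κ) ℂ := of fun i j => φ (single j.1 j.2 1) i.1 i.2 with hG
  have hGmul : ∀ (Z : Matrix κ κ ℂ) (i : ι × ι),
      (G *ᵥ fun j => Z j.1 j.2) i = φ Z i.1 i.2 := by
    intro Z i
    conv_rhs => rw [Matrix.matrix_eq_sum_single Z]
    simp only [map_sum, Matrix.sum_apply, mulVec, dotProduct, hG, of_apply,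
      Fintype.sum_prod_type]
    refine Finset.sum_congr rfl fun a _ => Finset.sum_congr rfl fun b _ => ?_
    have : single a b (Z a b) = Z a b • single a b (1 : ℂ) := by simp [smul_single]
    rw [this, map_smul, Matrix.smul_apply, smul_eq_mul, mul_comm]
  have hentry : ∀ (p : ι × ι → ℂ) (j j' : κ × κ), (Gᴴ * diagonal p * G) j j' =
      ∑ i : ι × ι, star (φ (single j.1 j.2 1) i.1 i.2) * p i * φ (single j'.1 j'.2 1) i.1 i.2 := by
    intro p j j'
    rw [Matrix.mul_apply]
    exact Finset.sum_congr rfl fun i _ => by rw [Matrix.mul_diagonal]; rfl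
  have h1 : Gᴴ * diagonal (fun i : ι × ι => (l i.2 : ℂ)) * G =
      diagonal fun j : κ × κ => (μ j.2 : ℂ) := by
    ext j j'
    rw [hentry, ← trace_diagonal_mul_conjTranspose_mul (fun i => (l i : ℂ)), ← hφ_star, ← hφ_mul, hφ_tr,
      trace_diagonal_mul_conjTranspose_mul, sum_star_single_mul_single fun c => (μ c.2 : ℂ)]
  have h2 : Gᴴ * diagonal (fun i : ι × ι => (l i.1 : ℂ)) * G =
      diagonal fun j : κ × κ => (μ j.1 : ℂ) := by
    ext j j'
    rw [hentry, ← trace_diagonal_mul_mul_conjTranspose (fun i => (l i : ℂ)), ← hφ_star, ← hφ_mul, hφ_tr,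
      trace_diagonal_mul_mul_conjTranspose, sum_star_single_mul_single fun c => (μ c.1 : ℂ)]
  set Z : Matrix κ κ ℂ :=
    of fun a b => (((μ a - μ b) / (μ b * f (μ a / μ b)) : ℝ) : ℂ) * A a b with hZ
  have hJ := hf.sum_weight_mul_normSq_le hf_pos hf_symm (p := fun i : ι × ι => l i.2)
    (d := fun i => l i.1 / l i.2) (q := fun j : κ × κ => μ j.2) (e := fun j => μ j.1 / μ j.2)
    (fun i => hl _) (fun i => div_pos (hl _) (hl _)) (fun j => hμ _)
    (fun j => div_pos (hμ _) (hμ _)) h1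
    (by simpa only [mul_div_cancel₀ _ (hl _).ne', mul_div_cancel₀ _ (hμ _).ne'] using h2)
    (fun j => Z j.1 j.2)
  simp only [hGmul] at hJ
  have hpos : ∀ x y : ℝ, 0 < x → 0 < y → 0 < y * f (x / y) := fun x y hx hy =>
    mul_pos hy (hf_pos _ (div_pos hx hy))
  have hZsq : ∀ j : κ × κ, μ j.2 * f (μ j.1 / μ j.2) * Complex.normSq (Z j.1 j.2) =
      chat f (μ j.1) (μ j.2) * Complex.normSq (A j.1 j.2) := by
    intro j
    have := (hpos _ _ (hμ j.1) (hμ j.2)).ne'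
    rw [hZ, of_apply, Complex.normSq_mul, Complex.normSq_ofReal, chat]
    generalize μ j.2 * f (μ j.1 / μ j.2) = c at *
    field_simp
  simp only [hZsq] at hJ
  have htr := hHA Zᴴ
  rw [hφ_star, trace_mul_conjTranspose_eq_sum, trace_mul_conjTranspose_eq_sum] at htr
  have hR : ∑ j : κ × κ, (diagonal (fun a => (μ a : ℂ)) * A - A * diagonal (fun a => (μ a : ℂ)))
      j.1 j.2 * star (Z j.1 j.2) =
      ((∑ j : κ × κ, chat f (μ j.1) (μ j.2) * Complex.normSq (A j.1 j.2) : ℝ) : ℂ) := by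
    rw [Complex.ofReal_sum]
    refine Finset.sum_congr rfl fun j _ => ?_
    rw [Matrix.sub_apply, Matrix.diagonal_mul, Matrix.mul_diagonal, hZ, of_apply, star_mul',
      Complex.ofReal_mul, ← Complex.mul_conj, chat, Complex.star_def,
      Complex.conj_ofReal]
    push_cast
    ring
  rw [hR] at htr
  have hre := congrArg Complex.re htr
  rw [Complex.ofReal_re, Complex.re_sum] at hre
  have hle : ∀ i : ι × ι, ((diagonal (fun i => (l i : ℂ)) * H - H * diagonal (fun i => (l i : ℂ)))
      i.1 i.2 * star (φ Z i.1 i.2)).re ≤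
      (1 / 2) * (chat f (l i.1) (l i.2) * Complex.normSq (H i.1 i.2)) +
      (1 / 2) * (l i.2 * f (l i.1 / l i.2) * Complex.normSq (φ Z i.1 i.2)) := by
    intro i
    have hc := hpos _ _ (hl i.1) (hl i.2)
    rw [Matrix.sub_apply, Matrix.diagonal_mul, Matrix.mul_diagonal, chat]
    generalize l i.2 * f (l i.1 / l i.2) = c at *
    have e : (l i.1 : ℂ) * H i.1 i.2 - H i.1 i.2 * (l i.2 : ℂ) =
        ((l i.1 - l i.2 : ℝ) : ℂ) * H i.1 i.2 := by push_cast; ring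
    rw [e]
    generalize l i.1 - l i.2 = t
    generalize H i.1 i.2 = h
    generalize φ Z i.1 i.2 = w
    simp only [Complex.normSq_apply, Complex.mul_re, Complex.mul_im, Complex.star_def,
      Complex.conj_re, Complex.conj_im, Complex.ofReal_re, Complex.ofReal_im]
    have : 0 ≤ (1 / c) * ((t * h.re - c * w.re) ^ 2 + (t * h.im - c * w.im) ^ 2) := by positivity
    have e2 : (1 / c) * ((t * h.re - c * w.re) ^ 2 + (t * h.im - c * w.im) ^ 2) =
        t ^ 2 * (1 / c) * (h.re * h.re + h.im * h.im) + c * (w.re * w.re + w.im * w.im) -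
        2 * (t * h.re * w.re + t * h.im * w.im) := by
      field_simp
      ring
    linarith
  have hsum := Finset.sum_le_sum fun i (_ : i ∈ Finset.univ) => hle i
  rw [Finset.sum_add_distrib, ← Finset.mul_sum, ← Finset.mul_sum, hre] at hsum
  linarith

lemma skewSum_eq_sum_normSq (f : ℝ → ℝ) {ρ : Matrix ι ι ℂ} (hρ : ρ.IsHermitian)
    (A : Matrix ι ι ℂ) :
    skewSum f ρ A = ∑ i, ∑ j, chat f (hρ.eigenvalues i) (hρ.eigenvalues j) *
      Complex.normSq (((hρ.eigenvectorUnitary : Matrix ι ι ℂ)ᴴ * A *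
        (hρ.eigenvectorUnitary : Matrix ι ι ℂ)) i j) := by
  rw [skewSum, dif_pos hρ]
  refine Finset.sum_congr rfl fun i _ => Finset.sum_congr rfl fun j _ => ?_
  congr 2
  rw [Matrix.mul_assoc, Matrix.mul_apply]
  rfl

/-- Monotonicity of the metric adjusted skew information under restriction to a subsystem with
inclusion of observables `φ`, reduced state `σ` and reduced observable `A`. -/
lemma skewSum_le_skewSum {f : ℝ → ℝ} (hf : OperatorMonotone f) (hf_pos : ∀ t > 0, 0 < f t)
    (hf_symm : ∀ t > 0, f t = t * f (1 / t)) {ρ H : Matrix ι ι ℂ} {σ A : Matrix κ κ ℂ}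
    (hρ : ρ.PosDef) (hσ : σ.PosDef) (φ : Matrix κ κ ℂ →ₗ[ℂ] Matrix ι ι ℂ)
    (hφ_mul : ∀ X Y, φ (X * Y) = φ X * φ Y) (hφ_star : ∀ X, φ Xᴴ = (φ X)ᴴ)
    (hφ_tr : ∀ X, (ρ * φ X).trace = (σ * X).trace)
    (hHA : ∀ X, ((ρ * H - H * ρ) * φ X).trace = ((σ * A - A * σ) * X).trace) :
    skewSum f σ A ≤ skewSum f ρ H := by
  rw [skewSum_eq_sum_normSq f hρ.isHermitian, skewSum_eq_sum_normSq f hσ.isHermitian]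
  have hρU := hρ.isHermitian.eq_eigenvectorUnitary_mul
  have hσV := hσ.isHermitian.eq_eigenvectorUnitary_mul
  have hU1 := (Unitary.mem_iff.mp hρ.isHermitian.eigenvectorUnitary.2).1
  have hU2 := (Unitary.mem_iff.mp hρ.isHermitian.eigenvectorUnitary.2).2
  have hV1 := (Unitary.mem_iff.mp hσ.isHermitian.eigenvectorUnitary.2).1
  rw [star_eq_conjTranspose] at hU1 hU2 hV1
  have hl := hρ.eigenvalues_pos
  have hμ := hσ.eigenvalues_pos
  generalize hρ.isHermitian.eigenvalues = l at *
  generalize hσ.isHermitian.eigenvalues = μ at *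
  generalize (hρ.isHermitian.eigenvectorUnitary : Matrix ι ι ℂ) = U at *
  generalize (hσ.isHermitian.eigenvectorUnitary : Matrix κ κ ℂ) = V at *
  set L : Matrix ι ι ℂ := diagonal fun i => (l i : ℂ) with hL
  set M : Matrix κ κ ℂ := diagonal fun i => (μ i : ℂ) with hM
  have cU : ∀ X : Matrix ι ι ℂ, Uᴴ * (U * X) = X := fun X => by
    rw [← Matrix.mul_assoc, hU1, Matrix.one_mul]
  have cU' : ∀ X : Matrix ι ι ℂ, U * (Uᴴ * X) = X := fun X => by
    rw [← Matrix.mul_assoc, hU2, Matrix.one_mul]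
  have cV : ∀ X : Matrix κ κ ℂ, Vᴴ * (V * X) = X := fun X => by
    rw [← Matrix.mul_assoc, hV1, Matrix.one_mul]
  have hLρ : L = Uᴴ * ρ * U := by
    rw [hρU]; simp only [Matrix.mul_assoc, cU, hU1, Matrix.mul_one]
  have hMσ : M = Vᴴ * σ * V := by
    rw [hσV]; simp only [Matrix.mul_assoc, cV, hV1, Matrix.mul_one]
  have cyc : ∀ X Y : Matrix ι ι ℂ, (Uᴴ * X * U * (Uᴴ * Y * U)).trace = (X * Y).trace := by
    intro X Y
    simp only [Matrix.mul_assoc, cU']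
    rw [Matrix.trace_mul_comm]
    simp only [Matrix.mul_assoc, hU2, Matrix.mul_one]
  have cycV : ∀ X Y : Matrix κ κ ℂ, (X * (V * Y * Vᴴ)).trace = (Vᴴ * X * V * Y).trace := by
    intro X Y
    rw [← Matrix.mul_assoc, Matrix.trace_mul_comm]
    simp only [Matrix.mul_assoc]
  have comm : ∀ X : Matrix ι ι ℂ, L * (Uᴴ * X * U) - Uᴴ * X * U * L =
      Uᴴ * (ρ * X - X * ρ) * U := by
    intro X
    rw [hLρ, Matrix.mul_sub, Matrix.sub_mul]
    simp only [Matrix.mul_assoc, cU']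
  have hV2 : V * Vᴴ = 1 := mul_eq_one_comm.1 hV1
  have cV' : ∀ X : Matrix κ κ ℂ, V * (Vᴴ * X) = X := fun X => by
    rw [← Matrix.mul_assoc, hV2, Matrix.one_mul]
  have commV : ∀ X : Matrix κ κ ℂ, M * (Vᴴ * X * V) - Vᴴ * X * V * M =
      Vᴴ * (σ * X - X * σ) * V := by
    intro X
    rw [hMσ, Matrix.mul_sub, Matrix.sub_mul]
    simp only [Matrix.mul_assoc, cV']
  refine sum_chat_mul_normSq_le hf hf_pos hf_symm hl hμ
    { toFun := fun X => Uᴴ * φ (V * X * Vᴴ) * U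
      map_add' := fun X Y => by simp [Matrix.mul_add, Matrix.add_mul]
      map_smul' := fun c X => by simp } ?_ ?_ ?_ ?_
  · intro X Y
    have : V * (X * Y) * Vᴴ = V * X * Vᴴ * (V * Y * Vᴴ) := by
      simp only [Matrix.mul_assoc, cV]
    simp only [LinearMap.coe_mk, AddHom.coe_mk]
    rw [this, hφ_mul]
    simp only [Matrix.mul_assoc, cU']
  · intro X
    have : V * Xᴴ * Vᴴ = (V * X * Vᴴ)ᴴ := by
      simp [Matrix.mul_assoc]
    simp only [LinearMap.coe_mk, AddHom.coe_mk, this, hφ_star]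
    simp [Matrix.mul_assoc]
  · intro X
    simp only [LinearMap.coe_mk, AddHom.coe_mk, ← hL, ← hM]
    rw [hLρ, cyc, hφ_tr, cycV, hMσ]
  · intro X
    simp only [LinearMap.coe_mk, AddHom.coe_mk, ← hL, ← hM]
    rw [comm, commV, cyc, hHA, cycV]

end Monotonicity

section PartialTrace

variable {n m : ℕ}

lemma ptrace2_eq_sum (ρ : Matrix (Fin n × Fin m) (Fin n × Fin m) ℂ) :
    ptrace2 ρ = ∑ j, ρ.submatrix (·, j) (·, j) := by
  ext a b
  simp [ptrace2, Matrix.sum_apply]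

lemma ptrace1_eq_sum (ρ : Matrix (Fin n × Fin m) (Fin n × Fin m) ℂ) :
    ptrace1 ρ = ∑ i, ρ.submatrix (i, ·) (i, ·) := by
  ext a b
  simp [ptrace1, Matrix.sum_apply]

lemma Matrix.PosDef.ptrace2 [NeZero m] {ρ : Matrix (Fin n × Fin m) (Fin n × Fin m) ℂ}
    (hρ : ρ.PosDef) : (ptrace2 ρ).PosDef := by
  rw [ptrace2_eq_sum]
  exact posDef_sum Finset.univ_nonempty fun j _ => hρ.submatrix (Prod.mk_left_injective j)

lemma Matrix.PosDef.ptrace1 [NeZero n] {ρ : Matrix (Fin n × Fin m) (Fin n × Fin m) ℂ}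
    (hρ : ρ.PosDef) : (ptrace1 ρ).PosDef := by
  rw [ptrace1_eq_sum]
  exact posDef_sum Finset.univ_nonempty fun i _ => hρ.submatrix (Prod.mk_right_injective i)

lemma trace_mul_kronecker_one (ρ : Matrix (Fin n × Fin m) (Fin n × Fin m) ℂ)
    (X : Matrix (Fin n) (Fin n) ℂ) :
    (ρ * (X ⊗ₖ (1 : Matrix (Fin m) (Fin m) ℂ))).trace = (ptrace2 ρ * X).trace := by
  simp only [Matrix.trace, diag_apply, Matrix.mul_apply, Fintype.sum_prod_type, kroneckerMap_apply,
    one_apply, mul_ite, mul_one, mul_zero, Finset.sum_ite_eq', Finset.mem_univ, if_true, ptrace2,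
    of_apply, Finset.sum_mul]
  exact Finset.sum_congr rfl fun _ _ => Finset.sum_comm

lemma trace_mul_one_kronecker (ρ : Matrix (Fin n × Fin m) (Fin n × Fin m) ℂ)
    (X : Matrix (Fin m) (Fin m) ℂ) :
    (ρ * ((1 : Matrix (Fin n) (Fin n) ℂ) ⊗ₖ X)).trace = (ptrace1 ρ * X).trace := by
  simp only [Matrix.trace, diag_apply, Matrix.mul_apply, Fintype.sum_prod_type, kroneckerMap_apply,
    one_apply, ite_mul, one_mul, zero_mul, mul_ite, mul_zero, Finset.sum_ite_irrel,
    Finset.sum_const_zero, Finset.sum_ite_eq', Finset.mem_univ, if_true, ptrace1, of_apply,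
    Finset.sum_mul]
  rw [Finset.sum_comm]
  exact Finset.sum_congr rfl fun _ _ => Finset.sum_comm

lemma trace_commutator_mul {ι : Type} [Fintype ι] (ρ H X : Matrix ι ι ℂ) :
    ((ρ * H - H * ρ) * X).trace = (ρ * (H * X - X * H)).trace := by
  rw [Matrix.sub_mul, Matrix.mul_sub, Matrix.trace_sub, Matrix.trace_sub, Matrix.mul_assoc,
    Matrix.mul_assoc H, Matrix.trace_mul_comm H, Matrix.mul_assoc]

end PartialTrace

/-- Weak superadditivity: `I^c_ρ(A ⊗ 1₂ + 1₁ ⊗ B) ≥ (1/2)·(I^c_{ρ₁}(A) + I^c_{ρ₂}(B))`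
for a regular `f ∈ F_op` with Morozova-Chentsov function `c`. -/
theorem Ic_weak_superadditive {n m : ℕ} (f : ℝ → ℝ)
    (hf_mono : OperatorMonotone f) (hf_pos : ∀ t > 0, 0 < f t)
    (hf_symm : ∀ t > 0, f t = t * f (1 / t)) (hf_one : f 1 = 1)
    (hf_reg : 0 < f 0)
    (hf_cont : Filter.Tendsto f (nhdsWithin 0 (Set.Ioi 0)) (nhds (f 0)))
    (ρ : Matrix (Fin n × Fin m) (Fin n × Fin m) ℂ) (hρ : ρ.PosDef) (hρtr : ρ.trace = 1)
    (A : Matrix (Fin n) (Fin n) ℂ) (hA : A.IsHermitian)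
    (B : Matrix (Fin m) (Fin m) ℂ) (hB : B.IsHermitian) :
    (1 / 2) * (Ic f (ptrace2 ρ) A + Ic f (ptrace1 ρ) B) ≤
      Ic f ρ (A ⊗ₖ (1 : Matrix (Fin m) (Fin m) ℂ) +
        (1 : Matrix (Fin n) (Fin n) ℂ) ⊗ₖ B) := by
  have hne : Nonempty (Fin n × Fin m) := by
    by_contra h
    rw [not_nonempty_iff] at h
    simp [Matrix.trace] at hρtr
  obtain ⟨⟨a⟩, ⟨b⟩⟩ := nonempty_prod.1 hne
  have : NeZero n := ⟨by rintro rfl; exact a.elim0⟩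
  have : NeZero m := ⟨by rintro rfl; exact b.elim0⟩
  set H := A ⊗ₖ (1 : Matrix (Fin m) (Fin m) ℂ) + (1 : Matrix (Fin n) (Fin n) ℂ) ⊗ₖ B with hH
  have h1 : skewSum f (ptrace2 ρ) A ≤ skewSum f ρ H := by
    refine skewSum_le_skewSum hf_mono hf_pos hf_symm hρ hρ.ptrace2
      { toFun := fun X => X ⊗ₖ (1 : Matrix (Fin m) (Fin m) ℂ)
        map_add' := fun X Y => add_kronecker X Y 1
        map_smul' := fun c X => smul_kronecker c X 1 } ?_ ?_ ?_ ?_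
    · intro X Y
      simp [← mul_kronecker_mul]
    · intro X
      simp [conjTranspose_kronecker]
    · exact trace_mul_kronecker_one ρ
    · intro X
      rw [trace_commutator_mul, trace_commutator_mul, ← trace_mul_kronecker_one]
      congr 2
      simp [hH, Matrix.add_mul, Matrix.mul_add, ← mul_kronecker_mul]
      rw [sub_eq_iff_eq_add, ← add_kronecker, sub_add_cancel]
  have h2 : skewSum f (ptrace1 ρ) B ≤ skewSum f ρ H := by
    refine skewSum_le_skewSum hf_mono hf_pos hf_symm hρ hρ.ptrace1
      { toFun := fun X => (1 : Matrix (Fin n) (Fin n) ℂ) ⊗ₖ X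
        map_add' := fun X Y => kronecker_add 1 X Y
        map_smul' := fun c X => kronecker_smul c 1 X } ?_ ?_ ?_ ?_
    · intro X Y
      simp [← mul_kronecker_mul]
    · intro X
      simp [conjTranspose_kronecker]
    · exact trace_mul_one_kronecker ρ
    · intro X
      rw [trace_commutator_mul, trace_commutator_mul, ← trace_mul_one_kronecker]
      congr 2
      simp [hH, Matrix.add_mul, Matrix.mul_add, ← mul_kronecker_mul]
      rw [sub_eq_iff_eq_add, ← kronecker_add, sub_add_cancel]
  unfold Ic
  nlinarith [mul_le_mul_of_nonneg_left h1 hf_reg.le, mul_le_mul_of_nonneg_left h2 hf_reg.le]
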